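/- Let α > 0. Let ψ = (ψ_k)_{k≥1} be nonnegative measurable functions with ‖ψ‖_{ℓ²(L²_α)} < ∞, and let η_k : ℝ → [0,∞) be even, increasing on [0,∞), with η̃(r) := (Σ_k η_k(r)²)^{1/2} < ∞ for every r. Let σ_k : [0,∞) × ℝ → ℝ be C¹ functions satisfying, for all x ≥ 0 and r, r₁, r₂ ∈ ℝ: |∂₂σ_k(x,r)| ≤ η_k(r), |∂₁σ_k(x,r₁) − ∂₁σ_k(x,r₂)| ≤ ψ_k(x)(η_k(r₁) + η_k(r₂))|r₁ − r₂|, and |∂₂σ_k(x,r₁) − ∂₂σ_k(x,r₂)| ≤ (η_k(r₁) + η_k(r₂))|r₁ − r₂|. Let v₁, v₂ : [0,∞) → ℝ be differentiable with ‖v₁'‖_{L²_α}, ‖v₂'‖_{L²_α} < ∞, sup_x |v₁(x)| ≤ M₁, sup_x |v₂(x)| ≤ M₂, and sup_x |v₁(x) − v₂(x)| ≤ D. Then ( Σ_k ∫₀^∞ | [∂₁σ_k(x,v₁(x)) + ∂₂σ_k(x,v₁(x)) v₁'(x)] − [∂₁σ_k(x,v₂(x)) + ∂₂σ_k(x,v₂(x))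 v₂'(x)] |² e^{αx} dx )^{1/2} ≤ (η̃(M₁) + η̃(M₂)) ( D ‖ψ‖_{ℓ²(L²_α)} + ‖v₁' − v₂'‖_{L²_α} + D ‖v₂'‖_{L²_α} ). (This is the local Lipschitz estimate for the superposition volatility operator σ : H_α → 𝓛²(U, H_α) in Musiela's equation.) -/

import Mathlib

open MeasureTheory Set Filter

/-- A weighted square is the square of the product of absolute value and root weight. -/
lemma ofReal_sq_mul_exp (α x y : ℝ) :
    ENNReal.ofReal (y ^ 2 * Real.exp (α * x)) =
      (ENNReal.ofReal |y| * ENNReal.ofReal (Real.exp (α * x / 2))) ^ (2 : ℝ) := by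
  rw [← ENNReal.ofReal_mul (abs_nonneg y), ENNReal.ofReal_rpow_of_nonneg (by positivity) (by norm_num)]
  congr 1
  rw [Real.rpow_two, mul_pow, sq_abs, ← Real.exp_nat_mul]
  congr 2
  push_cast
  ring

lemma ofReal_sq_eq_rpow {y : ℝ} (hy : 0 ≤ y) :
    ENNReal.ofReal (y ^ 2) = ENNReal.ofReal y ^ (2 : ℝ) := by
  rw [ENNReal.ofReal_rpow_of_nonneg hy (by norm_num), Real.rpow_two]

/-- Homogeneity of the `L²` norm of `ℝ≥0∞`-valued functions. -/
lemma lintegral_const_mul_sq_rpow_half {β : Type*} [MeasurableSpace β] (μ : Measure β)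
    {c : ENNReal} (hc : c ≠ ⊤) (f : β → ENNReal) :
    (∫⁻ x, (c * f x) ^ (2 : ℝ) ∂μ) ^ ((1 : ℝ) / 2) =
      c * (∫⁻ x, f x ^ (2 : ℝ) ∂μ) ^ ((1 : ℝ) / 2) := by
  simp_rw [ENNReal.mul_rpow_of_nonneg _ _ (zero_le_two : (0 : ℝ) ≤ 2)]
  rw [lintegral_const_mul' _ _ (ENNReal.rpow_ne_top_of_nonneg zero_le_two hc),
    ENNReal.mul_rpow_of_nonneg _ _ (by norm_num), ← ENNReal.rpow_mul]
  norm_num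

/-- Minkowski's inequality in `L²`. -/
lemma lintegral_add_sq_rpow_half_le {β : Type*} [MeasurableSpace β] {μ : Measure β}
    {f g : β → ENNReal} (hf : AEMeasurable f μ) (hg : AEMeasurable g μ) :
    (∫⁻ x, (f x + g x) ^ (2 : ℝ) ∂μ) ^ ((1 : ℝ) / 2) ≤
      (∫⁻ x, f x ^ (2 : ℝ) ∂μ) ^ ((1 : ℝ) / 2) + (∫⁻ x, g x ^ (2 : ℝ) ∂μ) ^ ((1 : ℝ) / 2) :=
  ENNReal.lintegral_Lp_add_le hf hg one_le_two

/-- Minkowski's inequality in `ℓ²`. -/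
lemma tsum_add_sq_rpow_half_le (f g : ℕ → ENNReal) :
    (∑' k, (f k + g k) ^ (2 : ℝ)) ^ ((1 : ℝ) / 2) ≤
      (∑' k, f k ^ (2 : ℝ)) ^ ((1 : ℝ) / 2) + (∑' k, g k ^ (2 : ℝ)) ^ ((1 : ℝ) / 2) := by
  simpa only [lintegral_count] using
    lintegral_add_sq_rpow_half_le (μ := Measure.count)
      (measurable_of_countable f).aemeasurable (measurable_of_countable g).aemeasurable

/-- The `ℓ²` norm is submultiplicative, with a constant `q` allowed in the second factor. -/
lemma tsum_mul_add_const_sq_rpow_half_le (a p : ℕ → ENNReal) (q : ENNReal) :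
    (∑' k, (a k * (p k + q)) ^ (2 : ℝ)) ^ ((1 : ℝ) / 2) ≤
      (∑' k, a k ^ (2 : ℝ)) ^ ((1 : ℝ) / 2) *
        ((∑' k, p k ^ (2 : ℝ)) ^ ((1 : ℝ) / 2) + q) := by
  simp_rw [mul_add]
  refine (tsum_add_sq_rpow_half_le _ _).trans (add_le_add ?_ ?_)
  · rw [← ENNReal.mul_rpow_of_nonneg _ _ (by norm_num)]
    refine ENNReal.rpow_le_rpow ?_ (by norm_num)
    rw [← ENNReal.tsum_mul_left]
    refine ENNReal.tsum_le_tsum fun k => ?_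
    rw [ENNReal.mul_rpow_of_nonneg _ _ zero_le_two]
    gcongr
    exact ENNReal.le_tsum k
  · simp_rw [ENNReal.mul_rpow_of_nonneg _ _ (zero_le_two : (0 : ℝ) ≤ 2)]
    rw [ENNReal.tsum_mul_right, ENNReal.mul_rpow_of_nonneg _ _ (by norm_num),
      ← ENNReal.rpow_mul q]
    norm_num

/-- A function that is a derivative on `[0, ∞)` is measurable there. -/
lemma aemeasurable_of_hasDerivAt_Ici {v v' : ℝ → ℝ}
    (hv : ∀ x : ℝ, 0 ≤ x → HasDerivAt v (v' x) x) :
    AEMeasurable v' (volume.restrict (Set.Ioi 0)) := by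
  refine (measurable_deriv v).aemeasurable.congr ?_
  filter_upwards [ae_restrict_mem measurableSet_Ioi] with x hx
  exact (hv x (le_of_lt hx)).deriv

/-- Local Lipschitz estimate for the superposition volatility operator in Musiela's equation:
with `d/dx[σ_k(x,v(x))] = ∂₁σ_k(x,v(x)) + ∂₂σ_k(x,v(x)) v'(x)`, if `|∂₂σ_k(x,r)| ≤ η_k(r)`,
`|∂₁σ_k(x,r₁) − ∂₁σ_k(x,r₂)| ≤ ψ_k(x)(η_k(r₁)+η_k(r₂))|r₁−r₂|`,
`|∂₂σ_k(x,r₁) − ∂₂σ_k(x,r₂)| ≤ (η_k(r₁)+η_k(r₂))|r₁−r₂|`, `sup |vᵢ| ≤ Mᵢ` and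
`sup |v₁−v₂| ≤ D`, then the `ℓ²(L²_α)`-distance of the derivative functions is at most
`(η̃(M₁)+η̃(M₂)) (D ‖ψ‖_{ℓ²(L²_α)} + ‖v₁'−v₂'‖_{L²_α} + D ‖v₂'‖_{L²_α})`. -/
theorem stmt19 (α : ℝ) (hα : 0 < α)
    (ψ : ℕ → ℝ → ℝ) (hψ0 : ∀ k x, 0 ≤ ψ k x) (hψm : ∀ k, Measurable (ψ k))
    (hψfin : (∑' k, ∫⁻ x in Set.Ioi (0:ℝ),
        ENNReal.ofReal ((ψ k x) ^ 2 * Real.exp (α * x))) < ⊤)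
    (η : ℕ → ℝ → ℝ) (hη0 : ∀ k r, 0 ≤ η k r)
    (hηeven : ∀ k r, η k (-r) = η k r)
    (hηmono : ∀ k, ∀ r₁ r₂ : ℝ, 0 ≤ r₁ → r₁ ≤ r₂ → η k r₁ ≤ η k r₂)
    (hηsum : ∀ r : ℝ, Summable (fun k => (η k r) ^ 2))
    (σ σ₁ σ₂ : ℕ → ℝ → ℝ → ℝ)
    (hσ₁ : ∀ k, ∀ r : ℝ, ∀ x : ℝ, 0 ≤ x → HasDerivAt (fun y => σ k y r) (σ₁ k x r) x)
    (hσ₂ : ∀ k, ∀ x : ℝ, 0 ≤ x → ∀ r : ℝ, HasDerivAt (fun s => σ k x s) (σ₂ k x r) r)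
    (hb2 : ∀ k, ∀ x : ℝ, 0 ≤ x → ∀ r : ℝ, |σ₂ k x r| ≤ η k r)
    (hl1 : ∀ k, ∀ x : ℝ, 0 ≤ x → ∀ r₁ r₂ : ℝ,
      |σ₁ k x r₁ - σ₁ k x r₂| ≤ ψ k x * (η k r₁ + η k r₂) * |r₁ - r₂|)
    (hl2 : ∀ k, ∀ x : ℝ, 0 ≤ x → ∀ r₁ r₂ : ℝ,
      |σ₂ k x r₁ - σ₂ k x r₂| ≤ (η k r₁ + η k r₂) * |r₁ - r₂|)
    (v₁ v₁' v₂ v₂' : ℝ → ℝ)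
    (hv₁ : ∀ x : ℝ, 0 ≤ x → HasDerivAt v₁ (v₁' x) x)
    (hv₂ : ∀ x : ℝ, 0 ≤ x → HasDerivAt v₂ (v₂' x) x)
    (hv₁'fin : (∫⁻ x in Set.Ioi (0:ℝ),
        ENNReal.ofReal ((v₁' x) ^ 2 * Real.exp (α * x))) < ⊤)
    (hv₂'fin : (∫⁻ x in Set.Ioi (0:ℝ),
        ENNReal.ofReal ((v₂' x) ^ 2 * Real.exp (α * x))) < ⊤)
    (M₁ M₂ D : ℝ)
    (hM₁ : ∀ x : ℝ, 0 ≤ x → |v₁ x| ≤ M₁)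
    (hM₂ : ∀ x : ℝ, 0 ≤ x → |v₂ x| ≤ M₂)
    (hD : ∀ x : ℝ, 0 ≤ x → |v₁ x - v₂ x| ≤ D) :
    (∑' k, ∫⁻ x in Set.Ioi (0:ℝ),
        ENNReal.ofReal
          (((σ₁ k x (v₁ x) + σ₂ k x (v₁ x) * v₁' x)
            - (σ₁ k x (v₂ x) + σ₂ k x (v₂ x) * v₂' x)) ^ 2 *
            Real.exp (α * x))) ^ ((1:ℝ)/2)
      ≤ ((∑' k, ENNReal.ofReal ((η k M₁) ^ 2)) ^ ((1:ℝ)/2)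
          + (∑' k, ENNReal.ofReal ((η k M₂) ^ 2)) ^ ((1:ℝ)/2)) *
        (ENNReal.ofReal D *
            (∑' k, ∫⁻ x in Set.Ioi (0:ℝ),
              ENNReal.ofReal ((ψ k x) ^ 2 * Real.exp (α * x))) ^ ((1:ℝ)/2)
          + (∫⁻ x in Set.Ioi (0:ℝ),
              ENNReal.ofReal ((v₁' x - v₂' x) ^ 2 * Real.exp (α * x))) ^ ((1:ℝ)/2)
          + ENNReal.ofReal D *
              (∫⁻ x in Set.Ioi (0:ℝ),
                ENNReal.ofReal ((v₂' x) ^ 2 * Real.exp (α * x))) ^ ((1:ℝ)/2)) := by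
  have hD0 : 0 ≤ D := (abs_nonneg _).trans (hD 0 le_rfl)
  have hη : ∀ k (r M : ℝ), |r| ≤ M → η k r ≤ η k M := fun k r M h => by
    have habs : η k |r| = η k r := by
      rcases abs_choice r with h' | h' <;> rw [h']
      exact hηeven k r
    exact habs ▸ hηmono k _ _ (abs_nonneg r) h
  have hpt : ∀ k x, 0 ≤ x →
      |(σ₁ k x (v₁ x) + σ₂ k x (v₁ x) * v₁' x) - (σ₁ k x (v₂ x) + σ₂ k x (v₂ x) * v₂' x)|
        ≤ (η k M₁ + η k M₂) * (D * |ψ k x| + (|v₁' x - v₂' x| + D * |v₂' x|)) := by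
    intro k x hx
    have e₁ := hη k _ _ (hM₁ x hx)
    have e₂ := hη k _ _ (hM₂ x hx)
    have hE : η k (v₁ x) + η k (v₂ x) ≤ η k M₁ + η k M₂ := add_le_add e₁ e₂
    have hE0 : 0 ≤ η k M₁ + η k M₂ := add_nonneg (hη0 _ _) (hη0 _ _)
    have t₁ : |σ₁ k x (v₁ x) - σ₁ k x (v₂ x)| ≤ ψ k x * (η k M₁ + η k M₂) * D :=
      (hl1 k x hx _ _).trans (mul_le_mul (mul_le_mul_of_nonneg_left hE (hψ0 k x)) (hD x hx)
        (abs_nonneg _) (mul_nonneg (hψ0 k x) hE0))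
    have t₂ : |σ₂ k x (v₁ x)| ≤ η k M₁ + η k M₂ :=
      (hb2 k x hx _).trans (e₁.trans (le_add_of_nonneg_right (hη0 _ _)))
    have t₃ : |σ₂ k x (v₁ x) - σ₂ k x (v₂ x)| ≤ (η k M₁ + η k M₂) * D :=
      (hl2 k x hx _ _).trans (mul_le_mul hE (hD x hx) (abs_nonneg _) hE0)
    calc _ = |(σ₁ k x (v₁ x) - σ₁ k x (v₂ x)) + σ₂ k x (v₁ x) * (v₁' x - v₂' x)
              + (σ₂ k x (v₁ x) - σ₂ k x (v₂ x)) * v₂' x| := by congr 1; ring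
      _ ≤ |σ₁ k x (v₁ x) - σ₁ k x (v₂ x)| + |σ₂ k x (v₁ x)| * |v₁' x - v₂' x|
              + |σ₂ k x (v₁ x) - σ₂ k x (v₂ x)| * |v₂' x| := by
          rw [← abs_mul, ← abs_mul]
          exact abs_add_three _ _ _
      _ ≤ ψ k x * (η k M₁ + η k M₂) * D + (η k M₁ + η k M₂) * |v₁' x - v₂' x|
              + (η k M₁ + η k M₂) * D * |v₂' x| := by gcongr
      _ = _ := by rw [abs_of_nonneg (hψ0 k x)]; ring
  have hm₁ := aemeasurable_of_hasDerivAt_Ici hv₁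
  have hm₂ := aemeasurable_of_hasDerivAt_Ici hv₂
  simp_rw [ofReal_sq_mul_exp, fun k r => ofReal_sq_eq_rpow (hη0 k r)]
  set w : ℝ → ENNReal := fun x => ENNReal.ofReal (Real.exp (α * x / 2)) with hw
  have hwm : Measurable w := by fun_prop
  set P : ℕ → ENNReal := fun k =>
    (∫⁻ x in Set.Ioi (0:ℝ), (ENNReal.ofReal |ψ k x| * w x) ^ (2:ℝ)) ^ ((1:ℝ)/2) with hP
  set G : ENNReal :=
    (∫⁻ x in Set.Ioi (0:ℝ), (ENNReal.ofReal |v₁' x - v₂' x| * w x) ^ (2:ℝ)) ^ ((1:ℝ)/2) with hG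
  set H : ENNReal :=
    (∫⁻ x in Set.Ioi (0:ℝ), (ENNReal.ofReal |v₂' x| * w x) ^ (2:ℝ)) ^ ((1:ℝ)/2) with hH
  set d : ENNReal := ENNReal.ofReal D with hd
  set a : ℕ → ENNReal := fun k => ENNReal.ofReal (η k M₁) + ENNReal.ofReal (η k M₂) with ha
  have hsq : ∀ y : ENNReal, (y ^ ((1:ℝ)/2)) ^ (2:ℝ) = y := fun y => by
    rw [← ENNReal.rpow_mul]; norm_num
  have hk : ∀ k, (∫⁻ x in Set.Ioi (0:ℝ),
      (ENNReal.ofReal |(σ₁ k x (v₁ x) + σ₂ k x (v₁ x) * v₁' x)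
        - (σ₁ k x (v₂ x) + σ₂ k x (v₂ x) * v₂' x)| * w x) ^ (2:ℝ))
      ≤ (a k * (d * P k + (G + d * H))) ^ (2:ℝ) := by
    intro k
    have hψk : AEMeasurable (ψ k) (volume.restrict (Set.Ioi 0)) := (hψm k).aemeasurable
    have hak : a k ≠ ⊤ := by simp [ha]
    rw [← hsq (∫⁻ x in Set.Ioi (0:ℝ), _)]
    refine ENNReal.rpow_le_rpow ?_ zero_le_two
    calc _ ≤ (∫⁻ x in Set.Ioi (0:ℝ), (a k * (d * (ENNReal.ofReal |ψ k x| * w x)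
            + (ENNReal.ofReal |v₁' x - v₂' x| * w x
              + d * (ENNReal.ofReal |v₂' x| * w x)))) ^ (2:ℝ)) ^ ((1:ℝ)/2) := by
          refine ENNReal.rpow_le_rpow (setLIntegral_mono' measurableSet_Ioi fun x hx => ?_)
            (by norm_num)
          refine ENNReal.rpow_le_rpow ?_ zero_le_two
          refine (mul_le_mul_left (ENNReal.ofReal_le_ofReal (hpt k x (le_of_lt hx))) _).trans_eq ?_
          rw [ENNReal.ofReal_mul (add_nonneg (hη0 _ _) (hη0 _ _)),
            ENNReal.ofReal_add (hη0 _ _) (hη0 _ _),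
            ENNReal.ofReal_add (by positivity) (by positivity),
            ENNReal.ofReal_add (by positivity) (by positivity),
            ENNReal.ofReal_mul hD0, ENNReal.ofReal_mul hD0]
          ring
      _ ≤ a k * (d * P k + (G + d * H)) := by
          rw [lintegral_const_mul_sq_rpow_half _ hak]
          gcongr
          refine (lintegral_add_sq_rpow_half_le (by fun_prop) (by fun_prop)).trans ?_
          rw [lintegral_const_mul_sq_rpow_half _ ENNReal.ofReal_ne_top]
          gcongr
          refine (lintegral_add_sq_rpow_half_le (by fun_prop) (by fun_prop)).trans ?_
          rw [lintegral_const_mul_sq_rpow_half _ ENNReal.ofReal_ne_top]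
  refine (ENNReal.rpow_le_rpow (ENNReal.tsum_le_tsum hk) (by norm_num)).trans ?_
  refine (tsum_mul_add_const_sq_rpow_half_le a (fun k => d * P k) (G + d * H)).trans ?_
  refine mul_le_mul' (tsum_add_sq_rpow_half_le _ _) (le_of_eq ?_)
  have hdP : (∑' k, (d * P k) ^ (2:ℝ)) ^ ((1:ℝ)/2) = d * (∑' k, P k ^ (2:ℝ)) ^ ((1:ℝ)/2) := by
    simpa only [lintegral_count] using
      lintegral_const_mul_sq_rpow_half Measure.count (ENNReal.ofReal_ne_top : d ≠ ⊤) P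
  rw [hdP, ← add_assoc]
  simp only [hP, hsq]
  rfl
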